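/- Fix an integer r ≥ 2. For all sufficiently large μ the following holds: for every integer s with μ^{5/9} < s < μ^{3/5} and every integer j with s/2 ≤ j < s and s - j ≥ 10s²/μ, one has P_{j+1} ≥ 2·P_j, where P_j is defined with respect to a partition of an rμ-element set R into μ parts of size r and a uniformly random s-element subset S of R. -/

import Mathlib

/-- We model a set `R` of size `rμ` partitioned into `μ` parts of size `r` as
`Fin μ × Fin r`, with parts `R_i = {i} × Fin r`. `sSubsets r μ s` is the set of all
`s`-element subsets of `R`; a uniformly random `s`-subset is a uniform element of it. -/
def sSubsets (r μ s : ℕ) : Finset (Finset (Fin μ × Fin r)) :=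
  Finset.powersetCard s (Finset.univ : Finset (Fin μ × Fin r))

/-- `X_S`, the number of parts `R_i` intersected by `S`. -/
def numPartsHit {μ r : ℕ} (S : Finset (Fin μ × Fin r)) : ℕ :=
  (S.image Prod.fst).card

/-- The probability, for a uniformly random `s`-element subset `S` of `R`,
of the event `P S`. -/
noncomputable def subsetProb (r μ s : ℕ) (P : Finset (Fin μ × Fin r) → Prop)
    [DecidablePred P] : ℝ :=
  (((sSubsets r μ s).filter P).card : ℝ) / ((sSubsets r μ s).card : ℝ)

/-- `P_j`: the probability that `X_S = j` and every part meets `S` in at most two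
elements. -/
noncomputable def Pj (r μ s j : ℕ) : ℝ :=
  subsetProb r μ s (fun S => numPartsHit S = j ∧
    ∀ i : Fin μ, (S.filter (fun x => x.1 = i)).card ≤ 2)

open Filter

/-- The `s`-element subsets that hit exactly `j` parts, each in at most two elements. -/
def sparseSubsets (r μ s j : ℕ) : Finset (Finset (Fin μ × Fin r)) :=
  (sSubsets r μ s).filter fun S => numPartsHit S = j ∧
    ∀ i : Fin μ, (S.filter (fun x => x.1 = i)).card ≤ 2

lemma mem_sparseSubsets {r μ s j : ℕ} {S : Finset (Fin μ × Fin r)} :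
    S ∈ sparseSubsets r μ s j ↔ S.card = s ∧ (S.image Prod.fst).card = j ∧
      ∀ i : Fin μ, (S.filter (fun x => x.1 = i)).card ≤ 2 := by
  refine Finset.mem_filter.trans (and_congr_left' ?_)
  simp [sSubsets, Finset.mem_powersetCard]

/-- `T` arises from `S` by moving one element to a new place, while the part that it left is
still hit. -/
def IsMove {r μ : ℕ} (S T : Finset (Fin μ × Fin r)) : Prop :=
  ∃ x ∈ S, ∃ y ∉ S, T = insert y (S.erase x) ∧ x.1 ∈ T.image Prod.fst

lemma insert_erase_mem_sparseSubsets {r μ s j : ℕ} {S : Finset (Fin μ × Fin r)}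
    (hS : S ∈ sparseSubsets r μ s j) {x y : Fin μ × Fin r} (hx : x ∈ S)
    (hxS : x.1 ∈ (S.erase x).image Prod.fst) (hy : y.1 ∉ S.image Prod.fst) :
    insert y (S.erase x) ∈ sparseSubsets r μ s (j + 1) := by
  obtain ⟨hs, hj, h2⟩ := mem_sparseSubsets.1 hS
  have hyS : y ∉ S := fun h => hy (Finset.mem_image_of_mem _ h)
  have himage : (S.erase x).image Prod.fst = S.image Prod.fst := by
    conv_rhs => rw [← Finset.insert_erase hx, Finset.image_insert]
    rw [Finset.insert_eq_of_mem hxS]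
  refine mem_sparseSubsets.2 ⟨?_, ?_, fun i => ?_⟩
  · rw [Finset.card_insert_of_notMem (fun h => hyS (Finset.mem_of_mem_erase h)),
      Finset.card_erase_add_one hx, hs]
  · rw [Finset.image_insert, himage, Finset.card_insert_of_notMem hy, hj]
  · rw [Finset.filter_insert]
    split_ifs with hi
    · have : (S.erase x).filter (fun z => z.1 = i) = ∅ := by
        refine Finset.filter_eq_empty_iff.2 fun z hz hzi => hy ?_
        rw [hi, ← hzi]
        exact Finset.mem_image_of_mem _ (Finset.mem_of_mem_erase hz)
      simp [this]
    · exact (Finset.card_le_card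
        (Finset.filter_subset_filter _ (Finset.erase_subset _ _))).trans (h2 i)

lemma injOn_insert_erase {α : Type*} [DecidableEq α] (S : Finset α) :
    Set.InjOn (fun p : α × α => insert p.2 (S.erase p.1)) {p | p.1 ∈ S ∧ p.2 ∉ S} := by
  rintro ⟨x, y⟩ ⟨hx, hy⟩ ⟨x', y'⟩ ⟨hx', hy'⟩ h
  simp only [Finset.ext_iff, Finset.mem_insert, Finset.mem_erase] at h hx hy hx' hy'
  have h₁ := h x
  have h₂ := h y
  ext <;> grind

open Classical in
lemma le_card_bipartiteAbove_isMove {r μ s j : ℕ} {S : Finset (Fin μ × Fin r)}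
    (hS : S ∈ sparseSubsets r μ s j) :
    (s - j) * ((μ - j) * r) ≤
      ((sparseSubsets r μ s (j + 1)).bipartiteAbove IsMove S).card := by
  obtain ⟨hs, hj, -⟩ := mem_sparseSubsets.1 hS
  obtain ⟨U, hUS, hU⟩ : ∃ U ⊆ S, U.image Prod.fst = S.image Prod.fst ∧
      U.card = (S.image Prod.fst).card := by
    obtain ⟨U, hUS, hinj, himage⟩ := Finset.exists_subset_injOn_image_eq_of_surjOn
      (f := Prod.fst) (S : Set (Fin μ × Fin r)) (S.image Prod.fst)
      (by simpa using Set.surjOn_image Prod.fst (S : Set (Fin μ × Fin r)))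
    exact ⟨U, by exact_mod_cast hUS, himage, by rw [← himage, Finset.card_image_of_injOn hinj]⟩
  obtain ⟨hUimage, hUcard⟩ := hU
  have hcard : ((S \ U) ×ˢ ((S.image Prod.fst)ᶜ ×ˢ (Finset.univ : Finset (Fin r)))).card =
      (s - j) * ((μ - j) * r) := by
    rw [Finset.card_product, Finset.card_product, Finset.card_sdiff_of_subset hUS, hUcard, hj,
      hs, Finset.card_compl, hj]
    simp
  rw [← hcard]
  refine Finset.card_le_card_of_injOn (fun p => insert p.2 (S.erase p.1)) ?_
    ((injOn_insert_erase S).mono ?_)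
  · rintro ⟨x, y⟩ hp
    simp only [Finset.coe_product, Set.mem_prod, Finset.mem_coe, Finset.mem_sdiff,
      Finset.mem_compl, Finset.mem_univ, and_true] at hp
    obtain ⟨⟨hx, hxU⟩, hy⟩ := hp
    have hxS : x.1 ∈ (S.erase x).image Prod.fst := by
      have hx' := Finset.mem_image_of_mem Prod.fst hx
      rw [← hUimage] at hx'
      refine Finset.image_subset_image (fun z hz => ?_) hx'
      exact Finset.mem_erase.2 ⟨fun h => hxU (h ▸ hz), hUS hz⟩
    refine Finset.mem_coe.2 (Finset.mem_filter.2
      ⟨insert_erase_mem_sparseSubsets hS hx hxS hy, x, hx, y,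
        fun h => hy (Finset.mem_image_of_mem _ h), rfl, ?_⟩)
    exact Finset.image_subset_image (Finset.subset_insert _ _) hxS
  · rintro ⟨x, y⟩ hp
    simp only [Finset.coe_product, Set.mem_prod, Finset.mem_coe, Finset.mem_sdiff,
      Finset.mem_compl, Finset.mem_univ, and_true] at hp
    exact ⟨hp.1.1, fun h => hp.2 (Finset.mem_image_of_mem _ h)⟩

open Classical in
lemma card_bipartiteBelow_isMove_le {r μ s k : ℕ} {T : Finset (Fin μ × Fin r)}
    (hT : T ∈ sparseSubsets r μ s k) (F : Finset (Finset (Fin μ × Fin r))) :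
    (F.bipartiteBelow IsMove T).card ≤ s * (k * r) := by
  obtain ⟨hs, hk, -⟩ := mem_sparseSubsets.1 hT
  have hsub : F.bipartiteBelow IsMove T ⊆
      (T ×ˢ (T.image Prod.fst ×ˢ (Finset.univ : Finset (Fin r)))).image
        (fun p => insert p.2 (T.erase p.1)) := by
    intro S hS
    obtain ⟨x, hx, y, hy, rfl, hxT⟩ := (Finset.mem_filter.1 hS).2
    refine Finset.mem_image.2 ⟨(y, x), ?_, ?_⟩
    · exact Finset.mem_product.2 ⟨Finset.mem_insert_self _ _,
        Finset.mem_product.2 ⟨hxT, Finset.mem_univ _⟩⟩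
    · dsimp only
      rw [Finset.erase_insert (fun h => hy (Finset.mem_of_mem_erase h)), Finset.insert_erase hx]
  refine (Finset.card_le_card hsub).trans (Finset.card_image_le.trans ?_)
  rw [Finset.card_product, Finset.card_product, hs, hk, Finset.card_univ, Fintype.card_fin]

lemma card_sparseSubsets_mul_le (r μ s j : ℕ) :
    (sparseSubsets r μ s j).card * ((s - j) * ((μ - j) * r)) ≤
      (sparseSubsets r μ s (j + 1)).card * (s * ((j + 1) * r)) := by
  classical
  exact Finset.card_mul_le_card_mul IsMove (fun _ hS => le_card_bipartiteAbove_isMove hS)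
    (fun _ hT => card_bipartiteBelow_isMove_le hT _)

lemma two_mul_card_sparseSubsets_le {r μ s j : ℕ} (hr : 0 < r) (hsμ : 2 * s ≤ μ) (hjs : j < s)
    (h : 10 * (s : ℝ) ^ 2 / (μ : ℝ) ≤ (s : ℝ) - (j : ℝ)) :
    2 * ((sparseSubsets r μ s j).card : ℝ) ≤ (sparseSubsets r μ s (j + 1)).card := by
  have key : ((sparseSubsets r μ s j).card : ℝ) * (((s : ℝ) - j) * (((μ : ℝ) - j) * r)) ≤
      ((sparseSubsets r μ s (j + 1)).card : ℝ) * (s * ((j + 1) * r)) := by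
    have := card_sparseSubsets_mul_le r μ s j
    rw [← Nat.cast_sub hjs.le, ← Nat.cast_sub (show j ≤ μ by omega)]
    exact_mod_cast this
  have hr' : (0 : ℝ) < r := by exact_mod_cast hr
  have hs' : (0 : ℝ) < s := by exact_mod_cast (by omega : 0 < s)
  have hμ' : (0 : ℝ) < μ := by exact_mod_cast (by omega : 0 < μ)
  have hj' : (j : ℝ) + 1 ≤ s := by exact_mod_cast hjs
  have hsμ' : 2 * (s : ℝ) ≤ μ := by exact_mod_cast hsμ
  have hgap : 2 * (s : ℝ) ^ 2 ≤ ((s : ℝ) - j) * ((μ : ℝ) - j) := by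
    rw [div_le_iff₀ hμ'] at h
    nlinarith
  set a : ℝ := ((sparseSubsets r μ s j).card : ℝ)
  set b : ℝ := ((sparseSubsets r μ s (j + 1)).card : ℝ)
  have ha : 0 ≤ a := Nat.cast_nonneg _
  have hb : 0 ≤ b := Nat.cast_nonneg _
  refine le_of_mul_le_mul_right ?_ (by positivity : (0 : ℝ) < s ^ 2 * r)
  calc 2 * a * (s ^ 2 * r) = a * (2 * s ^ 2 * r) := by ring
    _ ≤ a * (((s : ℝ) - j) * ((μ : ℝ) - j) * r) := by gcongr
    _ = a * (((s : ℝ) - j) * (((μ : ℝ) - j) * r)) := by ring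
    _ ≤ b * (s * ((j + 1) * r)) := key
    _ ≤ b * (s * (s * r)) := by gcongr
    _ = b * (s ^ 2 * r) := by ring

lemma eventually_two_mul_rpow_le :
    ∀ᶠ μ : ℕ in atTop, 2 * (μ : ℝ) ^ ((3 : ℝ) / 5) ≤ μ := by
  have h := (tendsto_rpow_atTop (by norm_num : (0 : ℝ) < 2 / 5)).comp
    (tendsto_natCast_atTop_atTop (R := ℝ))
  filter_upwards [h.eventually_ge_atTop 2, eventually_gt_atTop 0] with μ hμ hpos
  have hpos' : (0 : ℝ) < μ := by exact_mod_cast hpos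
  calc 2 * (μ : ℝ) ^ ((3 : ℝ) / 5) ≤ (μ : ℝ) ^ ((2 : ℝ) / 5) * (μ : ℝ) ^ ((3 : ℝ) / 5) := by
        gcongr
        exact hμ
    _ = μ := by
        rw [← Real.rpow_add hpos']
        norm_num

/-- For fixed `r ≥ 2` and all large `μ`: if `μ^{5/9} < s < μ^{3/5}`, `s/2 ≤ j < s`
and `s - j ≥ 10s²/μ`, then `P_{j+1} ≥ 2·P_j`. -/
theorem Pj_ratio_large (r : ℕ) (hr : 2 ≤ r) :
    ∀ᶠ μ : ℕ in atTop, ∀ s j : ℕ,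
      (μ : ℝ) ^ ((5 : ℝ) / 9) < (s : ℝ) → (s : ℝ) < (μ : ℝ) ^ ((3 : ℝ) / 5) →
      (s : ℝ) / 2 ≤ (j : ℝ) → j < s →
      10 * (s : ℝ) ^ 2 / (μ : ℝ) ≤ (s : ℝ) - (j : ℝ) →
      2 * Pj r μ s j ≤ Pj r μ s (j + 1) := by
  filter_upwards [eventually_two_mul_rpow_le] with μ hμ s j _ hs _ hjs h
  have hsμ : 2 * s ≤ μ := by
    have : 2 * (s : ℝ) ≤ μ := by linarith
    exact_mod_cast this
  have hcard := two_mul_card_sparseSubsets_le (by omega : 0 < r) hsμ hjs h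
  change 2 * (((sparseSubsets r μ s j).card : ℝ) / _) ≤
    ((sparseSubsets r μ s (j + 1)).card : ℝ) / _
  rw [← mul_div_assoc]
  gcongr
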